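/- Let Ω be a bounded domain of ℝⁿ, n ≥ 2, let p > 1 and let Q ⊂ Ω be a closed cube. Suppose that for all vector fields v ∈ W^{1,p}(Ω)ⁿ one has ‖Dv‖_{L^p(Ω)} ≤ C { ‖ε(v)‖_{L^p(Ω)} + ‖Dv‖_{L^p(Q)} }. Then there exists C' > 0 such that for all u ∈ W^{1,p}(Ω) one has ∫_Ω |u(x) − u_Ω|^p dx ≤ C' ∫_Ω |∇u(x)|^p dx. -/

import Mathlib

open MeasureTheory Set Filter
open scoped ENNReal NNReal Topology

noncomputable section

abbrev Evec (n : ℕ) := EuclideanSpace ℝ (Fin n)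

/-- `ρ(x) = dist(x, ∂Ω)`, the distance to the boundary of `Ω`. -/
def bdist {n : ℕ} (Ω : Set (Evec n)) (x : Evec n) : ℝ := Metric.infDist x (frontier Ω)

/-- A bounded domain: open, connected and bounded. -/
def IsBoundedDomain {n : ℕ} (Ω : Set (Evec n)) : Prop :=
  IsOpen Ω ∧ IsConnected Ω ∧ Bornology.IsBounded Ω

/-- A closed cube in `ℝⁿ`. -/
def IsClosedCube {n : ℕ} (Q : Set (Evec n)) : Prop :=
  ∃ (c : Evec n) (r : ℝ), 0 < r ∧ Q = {x : Evec n | ∀ i, |x i - c i| ≤ r}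

/-- The weighted `p`-energy `∫_S |g(x)|^p ρ(x)^a dx`, where `ρ` is the distance
to the boundary of `Ω`. -/
def wIp {n : ℕ} (Ω S : Set (Evec n)) (p a : ℝ) (g : Evec n → ℝ) : ℝ≥0∞ :=
  ∫⁻ x in S, ENNReal.ofReal (|g x| ^ p * bdist Ω x ^ a)

/-- The weighted `L^p(S, ρ^a)` norm `(∫_S |g(x)|^p ρ(x)^a dx)^{1/p}`. -/
def wLp {n : ℕ} (Ω S : Set (Evec n)) (p a : ℝ) (g : Evec n → ℝ) : ℝ≥0∞ :=
  wIp Ω S p a g ^ (1 / p)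

/-- The weighted average `u_{Ω,a} = (∫_Ω ρ^a)⁻¹ ∫_Ω u ρ^a`. -/
def wAvg {n : ℕ} (Ω : Set (Evec n)) (a : ℝ) (u : Evec n → ℝ) : ℝ :=
  (∫ x in Ω, bdist Ω x ^ a)⁻¹ * ∫ x in Ω, u x * bdist Ω x ^ a

/-- `|∇u(x)|` for a scalar function `u`. -/
def gradLen {n : ℕ} (u : Evec n → ℝ) (x : Evec n) : ℝ := ‖fderiv ℝ u x‖

/-- The entry `∂v_i/∂x_j (x)` of the gradient matrix `Dv`. -/
def pder {n : ℕ} (v : Evec n → Evec n) (i j : Fin n) (x : Evec n) : ℝ :=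
  fderiv ℝ v x (EuclideanSpace.single j 1) i

/-- `|Dv(x)|`, the (Frobenius) norm of the gradient matrix of a vector field `v`. -/
def DvLen {n : ℕ} (v : Evec n → Evec n) (x : Evec n) : ℝ :=
  Real.sqrt (∑ i, ∑ j, pder v i j x ^ 2)

/-- `|ε(v)(x)|`, the norm of the symmetric part `ε_{ij}(v) = (∂v_i/∂x_j + ∂v_j/∂x_i)/2`
of the gradient matrix. -/
def epsLen {n : ℕ} (v : Evec n → Evec n) (x : Evec n) : ℝ :=
  Real.sqrt (∑ i, ∑ j, ((pder v i j x + pder v j i x) / 2) ^ 2)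

/-- `u ∈ W^{1,p}(Ω, ρ^a, ρ^b)` (scalar case). -/
def MemW1 {n : ℕ} (Ω : Set (Evec n)) (p a b : ℝ) (u : Evec n → ℝ) : Prop :=
  DifferentiableOn ℝ u Ω ∧ wIp Ω Ω p a u < ⊤ ∧ wIp Ω Ω p b (gradLen u) < ⊤

/-- `v ∈ W^{1,p}(Ω, ρ^a, ρ^b)ⁿ` (vector case). -/
def MemW1Vec {n : ℕ} (Ω : Set (Evec n)) (p a b : ℝ) (v : Evec n → Evec n) : Prop :=
  DifferentiableOn ℝ v Ω ∧ wIp Ω Ω p a (fun x => ‖v x‖) < ⊤ ∧ wIp Ω Ω p b (DvLen v) < ⊤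

/-- The weighted Poincaré inequality `(P_{p,a,b})`: there is `C > 0` such that
`∫_Ω |u - u_{Ω,a}|^p ρ^a ≤ C ∫_Ω |∇u|^p ρ^b` for all `u ∈ W^{1,p}(Ω,ρ^a,ρ^b)`. -/
def PoincareIneq {n : ℕ} (Ω : Set (Evec n)) (p a b : ℝ) : Prop :=
  ∃ C > 0, ∀ u : Evec n → ℝ, MemW1 Ω p a b u →
    wIp Ω Ω p a (fun x => u x - wAvg Ω a u) ≤ ENNReal.ofReal C * wIp Ω Ω p b (gradLen u)

section SegmentIntegral

variable {E : Type*} [NormedAddCommGroup E] [NormedSpace ℝ E] [MeasurableSpace E] [BorelSpace E]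
  [FiniteDimensional ℝ E] (μ : Measure E) [μ.IsAddHaarMeasure]

lemma lintegral_comp_add_smul {g : E → ℝ≥0∞} (hg : Measurable g) (b : E) {c : ℝ} (hc : c ≠ 0) :
    ∫⁻ y, g (b + c • y) ∂μ
      = ENNReal.ofReal |(c ^ Module.finrank ℝ E)⁻¹| * ∫⁻ y, g y ∂μ := by
  have hgb : Measurable fun z => g (b + z) := hg.comp (measurable_const_add b)
  rw [← lintegral_map (f := fun z => g (b + z)) hgb (measurable_const_smul c),
    Measure.map_addHaar_smul μ hc, lintegral_smul_measure, lintegral_add_left_eq_self, smul_eq_mul]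

/-- The mass of `g` along the homothetic copy `b + c • (Q - b)`, `1/2 ≤ c`, of a convex set. -/
lemma setLIntegral_comp_homothety_le {g : E → ℝ≥0∞} (hg : Measurable g) {Q : Set E}
    (hQ : Convex ℝ Q) (hQm : MeasurableSet Q) {b : E} (hb : b ∈ Q) {c : ℝ} (hc : 1 / 2 ≤ c)
    (hc1 : c ≤ 1) :
    ∫⁻ y in Q, g ((1 - c) • b + c • y) ∂μ ≤ 2 ^ Module.finrank ℝ E * ∫⁻ y in Q, g y ∂μ := by
  have hc0 : 0 < c := by linarith
  calc ∫⁻ y in Q, g ((1 - c) • b + c • y) ∂μ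
      ≤ ∫⁻ y in Q, Q.indicator g ((1 - c) • b + c • y) ∂μ := by
        refine setLIntegral_mono ((hg.indicator hQm).comp (by fun_prop)) fun y hy => ?_
        rw [indicator_of_mem (hQ hb hy (by linarith) hc0.le (by ring))]
    _ ≤ ∫⁻ y, Q.indicator g ((1 - c) • b + c • y) ∂μ := setLIntegral_le_lintegral _ _
    _ = ENNReal.ofReal |(c ^ Module.finrank ℝ E)⁻¹| * ∫⁻ y in Q, g y ∂μ := by
        rw [lintegral_comp_add_smul μ (hg.indicator hQm) _ hc0.ne', lintegral_indicator hQm]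
    _ ≤ _ := by
        gcongr
        rw [abs_of_nonneg (by positivity), ← inv_pow, ENNReal.ofReal_pow (by positivity)]
        gcongr
        rw [← ENNReal.ofReal_ofNat]
        refine ENNReal.ofReal_le_ofReal ?_
        rw [inv_le_comm₀ hc0 two_pos]
        linarith

lemma setLIntegral_setLIntegral_comp_segment_le {g : E → ℝ≥0∞} (hg : Measurable g) {Q : Set E}
    (hQ : Convex ℝ Q) (hQm : MeasurableSet Q) {t : ℝ} (ht : t ∈ Icc (0 : ℝ) 1) :
    ∫⁻ y in Q, ∫⁻ x in Q, g ((1 - t) • y + t • x) ∂μ ∂μ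
      ≤ 2 ^ Module.finrank ℝ E * (∫⁻ y in Q, g y ∂μ) * μ Q := by
  rcases le_total (1 / 2) t with h | h
  · rw [← setLIntegral_const]
    exact setLIntegral_mono measurable_const fun y hy =>
      setLIntegral_comp_homothety_le μ hg hQ hQm hy h ht.2
  · rw [lintegral_lintegral_swap]
    · rw [← setLIntegral_const]
      refine setLIntegral_mono measurable_const fun x hx => ?_
      have := setLIntegral_comp_homothety_le μ hg hQ hQm hx (c := 1 - t) (by linarith)
        (by linarith [ht.1])
      simpa only [sub_sub_cancel, add_comm] using this
    · exact (hg.comp (f := fun z : E × E => (1 - t) • z.1 + t • z.2) (by fun_prop)).aemeasurable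

/-- Some point of `Q` from which the integral along segments is at most average. -/
lemma exists_setLIntegral_segment_le {g : E → ℝ≥0∞} (hg : Measurable g) {Q : Set E}
    (hQ : Convex ℝ Q) (hQm : MeasurableSet Q) (h0 : μ Q ≠ 0) (htop : μ Q ≠ ∞) :
    ∃ y ∈ Q, ∫⁻ x in Q, (∫⁻ t in Icc (0 : ℝ) 1, g ((1 - t) • y + t • x)) ∂μ
      ≤ 2 ^ Module.finrank ℝ E * ∫⁻ z in Q, g z ∂μ := by
  have hm3 : Measurable fun z : (E × E) × ℝ => g ((1 - z.2) • z.1.1 + z.2 • z.1.2) :=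
    hg.comp (by fun_prop)
  have hm2 : Measurable fun z : E × E => ∫⁻ t in Icc (0 : ℝ) 1, g ((1 - t) • z.1 + t • z.2) :=
    hm3.lintegral_prod_right'
  have hm1 : Measurable fun y : E =>
      ∫⁻ x in Q, (∫⁻ t in Icc (0 : ℝ) 1, g ((1 - t) • y + t • x)) ∂μ :=
    hm2.lintegral_prod_right'
  obtain ⟨y, hy, hle⟩ := exists_le_setLAverage h0 htop hm1.aemeasurable
  refine ⟨y, hy, hle.trans ?_⟩
  rw [setLAverage_eq]
  refine ENNReal.div_le_of_le_mul ?_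
  have hswap : ∫⁻ y in Q, ∫⁻ x in Q, (∫⁻ t in Icc (0 : ℝ) 1, g ((1 - t) • y + t • x)) ∂μ ∂μ
      = ∫⁻ t in Icc (0 : ℝ) 1, ∫⁻ y in Q, ∫⁻ x in Q, g ((1 - t) • y + t • x) ∂μ ∂μ := by
    have hx : ∀ y, ∫⁻ x in Q, (∫⁻ t in Icc (0 : ℝ) 1, g ((1 - t) • y + t • x)) ∂μ
        = ∫⁻ t in Icc (0 : ℝ) 1, ∫⁻ x in Q, g ((1 - t) • y + t • x) ∂μ := fun y =>
      lintegral_lintegral_swap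
        (hg.comp (f := fun z : E × ℝ => (1 - z.2) • y + z.2 • z.1) (by fun_prop)).aemeasurable
    simp_rw [hx]
    refine lintegral_lintegral_swap (Measurable.aemeasurable ?_)
    exact (hg.comp (f := fun z : (E × ℝ) × E => (1 - z.1.2) • z.1.1 + z.1.2 • z.2)
      (by fun_prop)).lintegral_prod_right'
  rw [hswap]
  calc _ ≤ ∫⁻ _ in Icc (0 : ℝ) 1, 2 ^ Module.finrank ℝ E * (∫⁻ y in Q, g y ∂μ) * μ Q :=
        setLIntegral_mono measurable_const fun t ht =>
          setLIntegral_setLIntegral_comp_segment_le μ hg hQ hQm ht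
    _ = _ := by simp

end SegmentIntegral

section Poincare

lemma eLpNorm_ofReal_eq {α F : Type*} [MeasurableSpace α] [NormedAddCommGroup F] {μ : Measure α}
    {p : ℝ} (hp : 0 < p) (f : α → F) :
    eLpNorm f (ENNReal.ofReal p) μ = (∫⁻ x, ‖f x‖ₑ ^ p ∂μ) ^ (1 / p) := by
  rw [eLpNorm_eq_lintegral_rpow_enorm_toReal (by simpa) ENNReal.ofReal_ne_top,
    ENNReal.toReal_ofReal hp.le]

variable {E : Type*} [NormedAddCommGroup E] [NormedSpace ℝ E]

/-- The mean value inequality in integral form, without integrability of the derivative. -/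
lemma enorm_sub_le_lintegral_of_hasDerivAt {f f' : ℝ → ℝ}
    (hf : ∀ t ∈ Icc (0 : ℝ) 1, HasDerivAt f (f' t) t) (hm : Measurable f') :
    ‖f 1 - f 0‖ₑ ≤ ∫⁻ t in Icc (0 : ℝ) 1, ‖f' t‖ₑ := by
  by_cases hi : IntervalIntegrable f' volume 0 1
  · rw [← intervalIntegral.integral_eq_sub_of_hasDerivAt (by rwa [uIcc_of_le zero_le_one]) hi,
      intervalIntegral.integral_of_le zero_le_one, ← integral_Icc_eq_integral_Ioc]
    exact enorm_integral_le_lintegral_enorm _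
  · refine le_of_le_of_eq le_top (Eq.symm ?_)
    by_contra hne
    refine hi ((intervalIntegrable_iff_integrableOn_Icc_of_le zero_le_one).2
      ⟨hm.aestronglyMeasurable, ?_⟩)
    exact lt_top_iff_ne_top.2 hne

lemma enorm_sub_rpow_le_lintegral_segment [MeasurableSpace E] [BorelSpace E] {Q : Set E}
    (hQ : Convex ℝ Q) {u : E → ℝ} (hu : ∀ x ∈ Q, DifferentiableAt ℝ u x) {p : ℝ} (hp : 1 ≤ p)
    {x y : E} (hx : x ∈ Q) (hy : y ∈ Q) :
    ‖u x - u y‖ₑ ^ p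
      ≤ ‖x - y‖ₑ ^ p * ∫⁻ t in Icc (0 : ℝ) 1, ‖fderiv ℝ u ((1 - t) • y + t • x)‖ₑ ^ p := by
  have hp0 : 0 < p := by linarith
  have hmg : Measurable fun t : ℝ => fderiv ℝ u ((1 - t) • y + t • x) :=
    (measurable_fderiv ℝ u).comp (by fun_prop : Continuous _).measurable
  have hgn : Measurable fun t : ℝ => ‖fderiv ℝ u ((1 - t) • y + t • x)‖ₑ := hmg.enorm
  have hderiv : ∀ t ∈ Icc (0 : ℝ) 1, HasDerivAt (fun t : ℝ => u ((1 - t) • y + t • x))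
      (fderiv ℝ u ((1 - t) • y + t • x) (x - y)) t := by
    intro t ht
    have h1 : HasDerivAt (fun t : ℝ => (1 - t) • y + t • x) (x - y) t := by
      have : HasDerivAt (fun t : ℝ => (1 - t) • y + t • x) _ t := (((hasDerivAt_id t).const_sub 1).smul_const y).add
        ((hasDerivAt_id t).smul_const x)
      simpa [neg_add_eq_sub] using this
    exact (hu _ (hQ hy hx (by linarith [ht.2]) ht.1 (by ring))).hasFDerivAt.comp_hasDerivAt t h1
  have hle := enorm_sub_le_lintegral_of_hasDerivAt hderiv
    ((ContinuousLinearMap.apply ℝ ℝ (x - y)).measurable.comp hmg)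
  simp only [sub_self, zero_smul, one_smul, zero_add, sub_zero, add_zero] at hle
  have hle' : ‖u x - u y‖ₑ
      ≤ ‖x - y‖ₑ * ∫⁻ t in Icc (0 : ℝ) 1, ‖fderiv ℝ u ((1 - t) • y + t • x)‖ₑ := by
    rw [← lintegral_const_mul _ hgn]
    refine hle.trans (lintegral_mono fun t => ?_)
    rw [mul_comm]
    exact ContinuousLinearMap.le_opENorm _ _
  refine (ENNReal.rpow_le_rpow hle' hp0.le).trans ?_
  rw [ENNReal.mul_rpow_of_nonneg _ _ hp0.le]
  gcongr
  have : IsProbabilityMeasure (volume.restrict (Icc (0 : ℝ) 1)) := ⟨by simp⟩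
  have hJ := eLpNorm_le_eLpNorm_of_exponent_le (μ := volume.restrict (Icc (0 : ℝ) 1))
    (p := 1) (q := ENNReal.ofReal p) (by simpa using hp)
    (f := fun t : ℝ => ‖fderiv ℝ u ((1 - t) • y + t • x)‖) hmg.norm.aestronglyMeasurable
  rw [eLpNorm_one_eq_lintegral_enorm, eLpNorm_eq_lintegral_rpow_enorm_toReal (by simpa)
    ENNReal.ofReal_ne_top, ENNReal.toReal_ofReal hp0.le] at hJ
  simp only [enorm_norm] at hJ
  refine (ENNReal.rpow_le_rpow hJ hp0.le).trans ?_
  rw [← ENNReal.rpow_mul, one_div_mul_cancel hp0.ne', ENNReal.rpow_one]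

/-- The Poincaré inequality on a bounded convex set, with some constant in place of the mean. -/
lemma exists_eLpNorm_sub_const_le_of_convex [MeasurableSpace E] [BorelSpace E]
    [FiniteDimensional ℝ E] (μ : Measure E) [μ.IsAddHaarMeasure] {Q : Set E}
    (hQ : Convex ℝ Q) (hQm : MeasurableSet Q) (hQb : Bornology.IsBounded Q) (h0 : μ Q ≠ 0)
    {p : ℝ} (hp : 1 ≤ p) :
    ∃ A : ℝ≥0, ∀ u : E → ℝ, (∀ x ∈ Q, DifferentiableAt ℝ u x) → ∃ c : ℝ,
      eLpNorm (fun x => u x - c) (ENNReal.ofReal p) (μ.restrict Q)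
        ≤ A * eLpNorm (fderiv ℝ u) (ENNReal.ofReal p) (μ.restrict Q) := by
  have hp0 : 0 < p := by linarith
  obtain ⟨R, hR⟩ := hQb.exists_norm_le
  refine ⟨(2 * R).toNNReal * (2 ^ Module.finrank ℝ E) ^ (1 / p), fun u hu => ?_⟩
  obtain ⟨y, hy, hle⟩ := exists_setLIntegral_segment_le μ
    (g := fun z => ‖fderiv ℝ u z‖ₑ ^ p) ((measurable_fderiv ℝ u).enorm.pow_const p) hQ hQm h0
    hQb.measure_lt_top.ne
  refine ⟨u y, ?_⟩
  rw [eLpNorm_ofReal_eq hp0, eLpNorm_ofReal_eq hp0, ENNReal.coe_mul, ENNReal.coe_rpow_of_nonneg _ (by positivity), mul_assoc,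
    ← ENNReal.mul_rpow_of_nonneg _ _ (by positivity)]
  have hR2 : ∀ x ∈ Q, ‖x - y‖ₑ ≤ ((2 * R).toNNReal : ℝ≥0∞) := by
    intro x hx
    rw [← ofReal_norm]
    refine ENNReal.ofReal_le_ofReal ((norm_sub_le _ _).trans ?_)
    linarith [hR x hx, hR y hy]
  have hmeas : Measurable fun x : E =>
      ∫⁻ t in Icc (0 : ℝ) 1, ‖fderiv ℝ u ((1 - t) • y + t • x)‖ₑ ^ p :=
    ((((measurable_fderiv ℝ u).enorm.pow_const p)).comp
      (f := fun z : E × ℝ => (1 - z.2) • y + z.2 • z.1) (by fun_prop)).lintegral_prod_right'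
  calc (∫⁻ x in Q, ‖u x - u y‖ₑ ^ p ∂μ) ^ (1 / p)
      ≤ (((2 * R).toNNReal : ℝ≥0∞) ^ p *
          (2 ^ Module.finrank ℝ E * ∫⁻ z in Q, ‖fderiv ℝ u z‖ₑ ^ p ∂μ)) ^ (1 / p) := by
        refine ENNReal.rpow_le_rpow ?_ (by positivity)
        refine le_trans ?_ (mul_le_mul_right hle _)
        rw [← lintegral_const_mul _ hmeas]
        refine setLIntegral_mono (hmeas.const_mul _) fun x hx => ?_
        refine (enorm_sub_rpow_le_lintegral_segment hQ hu hp hx hy).trans ?_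
        gcongr
        exact hR2 x hx
    _ = _ := by
        rw [ENNReal.mul_rpow_of_nonneg _ _ (by positivity : 0 ≤ 1 / p), ← ENNReal.rpow_mul,
          mul_one_div_cancel hp0.ne', ENNReal.rpow_one]
        simp

end Poincare

section Rotation

variable {n : ℕ}

lemma wIp_zero_eq (Ω S : Set (Evec n)) {p : ℝ} (hp : 0 ≤ p) (g : Evec n → ℝ) :
    wIp Ω S p 0 g = ∫⁻ x in S, ‖g x‖ₑ ^ p := by
  refine lintegral_congr fun x => ?_
  rw [Real.rpow_zero, mul_one, ← ENNReal.ofReal_rpow_of_nonneg (abs_nonneg _) hp,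
    Real.enorm_eq_ofReal_abs]

lemma wLp_zero_eq (Ω S : Set (Evec n)) {p : ℝ} (hp : 0 < p) (g : Evec n → ℝ) :
    wLp Ω S p 0 g = eLpNorm g (ENNReal.ofReal p) (volume.restrict S) := by
  rw [wLp, wIp_zero_eq Ω S hp.le, eLpNorm_ofReal_eq hp]

lemma wIp_zero_eq_eLpNorm_rpow (Ω S : Set (Evec n)) {p : ℝ} (hp : 0 < p) (g : Evec n → ℝ) :
    wIp Ω S p 0 g = eLpNorm g (ENNReal.ofReal p) (volume.restrict S) ^ p := by
  rw [← wLp_zero_eq Ω S hp, wLp, ← ENNReal.rpow_mul, one_div_mul_cancel hp.ne', ENNReal.rpow_one]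

lemma wIp_zero_lt_top_iff (Ω S : Set (Evec n)) {p : ℝ} (hp : 0 < p) (g : Evec n → ℝ) :
    wIp Ω S p 0 g < ∞ ↔ eLpNorm g (ENNReal.ofReal p) (volume.restrict S) < ∞ := by
  rw [wIp_zero_eq_eLpNorm_rpow Ω S hp, ENNReal.rpow_lt_top_iff_of_pos hp]

/-- The infinitesimal rotation in the plane of the coordinates `a`, `b`. -/
def infRotation (a b : Fin n) : Evec n →L[ℝ] Evec n :=
  (EuclideanSpace.proj b : Evec n →L[ℝ] ℝ).smulRight (EuclideanSpace.single a (1 : ℝ))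
    - (EuclideanSpace.proj a : Evec n →L[ℝ] ℝ).smulRight (EuclideanSpace.single b (1 : ℝ))

lemma infRotation_apply (a b : Fin n) (x : Evec n) (i : Fin n) :
    infRotation a b x i = (if i = a then x b else 0) - (if i = b then x a else 0) := by
  simp [infRotation]

lemma abs_infRotation_apply_le {a b : Fin n} (hab : a ≠ b) (x : Evec n) (i : Fin n) :
    |infRotation a b x i| ≤ ‖x‖ := by
  have h : ∀ j, |x j| ≤ ‖x‖ := fun j => PiLp.norm_apply_le x j
  rw [infRotation_apply]
  by_cases ha : i = a
  · subst ha
    simpa [hab] using h b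
  · by_cases hb : i = b
    · simpa [ha, hb, Ne.symm hab] using h a
    · simp [ha, hb]

lemma infRotation_single_antisymm (a b i j : Fin n) :
    infRotation a b (EuclideanSpace.single j 1) i
      = -infRotation a b (EuclideanSpace.single i 1) j := by
  simp only [infRotation_apply, PiLp.single_apply]
  grind

lemma infRotation_single_self {a b : Fin n} (hab : a ≠ b) :
    infRotation a b (EuclideanSpace.single b 1) a = 1 := by
  simp [infRotation_apply, hab]

lemma sqrt_sum_sum_sq_le {m : Fin n → Fin n → ℝ} {B : ℝ} (hB : 0 ≤ B)
    (hm : ∀ i j, |m i j| ≤ B) : √(∑ i, ∑ j, m i j ^ 2) ≤ n * B := by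
  refine Real.sqrt_le_iff.2 ⟨by positivity, ?_⟩
  calc ∑ i, ∑ j, m i j ^ 2 ≤ ∑ _i : Fin n, ∑ _j : Fin n, B ^ 2 :=
        Finset.sum_le_sum fun i _ => Finset.sum_le_sum fun j _ => sq_le_sq.2 (by
          rw [abs_of_nonneg hB]; exact hm i j)
    _ = (n * B) ^ 2 := by simp; ring

lemma abs_pder_le_DvLen (v : Evec n → Evec n) (i j : Fin n) (x : Evec n) :
    |pder v i j x| ≤ DvLen v x := by
  refine Real.le_sqrt_of_sq_le ?_
  rw [sq_abs]
  exact (Finset.single_le_sum (f := fun j => pder v i j x ^ 2) (fun _ _ => sq_nonneg _)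
    (Finset.mem_univ j)).trans (Finset.single_le_sum (f := fun i => ∑ j, pder v i j x ^ 2)
      (fun _ _ => Finset.sum_nonneg fun _ _ => sq_nonneg _) (Finset.mem_univ i))

lemma gradLen_nonneg (w : Evec n → ℝ) (x : Evec n) : 0 ≤ gradLen w x := norm_nonneg _

lemma DvLen_nonneg (v : Evec n → Evec n) (x : Evec n) : 0 ≤ DvLen v x := Real.sqrt_nonneg _

lemma epsLen_nonneg (v : Evec n → Evec n) (x : Evec n) : 0 ≤ epsLen v x := Real.sqrt_nonneg _

lemma measurable_gradLen (w : Evec n → ℝ) : Measurable (gradLen w) :=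
  (measurable_fderiv ℝ w).norm

lemma measurable_pder (v : Evec n → Evec n) (i j : Fin n) : Measurable (pder v i j) :=
  ((EuclideanSpace.proj i : Evec n →L[ℝ] ℝ).measurable).comp
    (measurable_fderiv_apply_const ℝ v _)

lemma measurable_DvLen (v : Evec n → Evec n) : Measurable (DvLen v) :=
  (Finset.measurable_sum _ fun i _ => Finset.measurable_sum _ fun j _ =>
    (measurable_pder v i j).pow_const 2).sqrt

variable {w : Evec n → ℝ} {x : Evec n} {a b : Fin n} {M : ℝ}

lemma pder_smul_infRotation (hw : DifferentiableAt ℝ w x) (i j : Fin n) :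
    pder (fun y => w y • infRotation a b y) i j x
      = w x * infRotation a b (EuclideanSpace.single j 1) i
        + fderiv ℝ w x (EuclideanSpace.single j 1) * infRotation a b x i := by
  have h := (hw.hasFDerivAt.smul (infRotation a b).hasFDerivAt (x := x)).fderiv
  rw [pder]
  erw [h]
  simp

lemma abs_fderiv_single_mul_infRotation_le (hab : a ≠ b) (hM : ‖x‖ ≤ M) (i j : Fin n) :
    |fderiv ℝ w x (EuclideanSpace.single j 1) * infRotation a b x i| ≤ M * gradLen w x := by
  rw [abs_mul, mul_comm]
  refine mul_le_mul ((abs_infRotation_apply_le hab x i).trans hM) ?_ (abs_nonneg _)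
    ((norm_nonneg x).trans hM)
  simpa [gradLen] using (fderiv ℝ w x).le_opNorm (EuclideanSpace.single j (1 : ℝ))

lemma abs_le_DvLen_smul_infRotation (hab : a ≠ b) (hw : DifferentiableAt ℝ w x) (hM : ‖x‖ ≤ M) :
    |w x| ≤ DvLen (fun y => w y • infRotation a b y) x + M * gradLen w x := by
  have h1 := abs_pder_le_DvLen (fun y => w y • infRotation a b y) a b x
  rw [pder_smul_infRotation hw, infRotation_single_self hab, mul_one] at h1
  have h2 := abs_fderiv_single_mul_infRotation_le (w := w) hab hM a b
  have h3 := abs_sub_abs_le_abs_add (w x)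
    (fderiv ℝ w x (EuclideanSpace.single b 1) * infRotation a b x a)
  linarith

lemma DvLen_smul_infRotation_le (hab : a ≠ b) (hw : DifferentiableAt ℝ w x) (hM : ‖x‖ ≤ M) :
    DvLen (fun y => w y • infRotation a b y) x ≤ n * (|w x| + M * gradLen w x) := by
  have hM0 := (norm_nonneg x).trans hM
  have hg := gradLen_nonneg w x
  refine sqrt_sum_sum_sq_le (by positivity) fun i j => ?_
  rw [pder_smul_infRotation hw]
  refine (abs_add_le _ _).trans
    (add_le_add ?_ (abs_fderiv_single_mul_infRotation_le hab hM i j))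
  rw [abs_mul]
  refine mul_le_of_le_one_right (abs_nonneg _) ?_
  simpa using abs_infRotation_apply_le hab (EuclideanSpace.single j (1 : ℝ)) i

lemma epsLen_smul_infRotation_le (hab : a ≠ b) (hw : DifferentiableAt ℝ w x) (hM : ‖x‖ ≤ M) :
    epsLen (fun y => w y • infRotation a b y) x ≤ n * (M * gradLen w x) := by
  have hM0 := (norm_nonneg x).trans hM
  have hg := gradLen_nonneg w x
  refine sqrt_sum_sum_sq_le (by positivity) fun i j => ?_
  rw [pder_smul_infRotation hw, pder_smul_infRotation hw, infRotation_single_antisymm a b i j]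
  have h1 := abs_le.1 (abs_fderiv_single_mul_infRotation_le (w := w) hab hM i j)
  have h2 := abs_le.1 (abs_fderiv_single_mul_infRotation_le (w := w) hab hM j i)
  rw [abs_le]
  constructor <;> linarith

end Rotation

section Korn

lemma eLpNorm_restrict_mono {α : Type*} [MeasurableSpace α] {μ : Measure α} {S : Set α}
    (hS : MeasurableSet S) {f g : α → ℝ} (h : ∀ x ∈ S, |f x| ≤ g x) (q : ℝ≥0∞) :
    eLpNorm f q (μ.restrict S) ≤ eLpNorm g q (μ.restrict S) :=
  eLpNorm_mono_ae_real (ae_restrict_of_forall_mem hS h)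

lemma eLpNorm_const_mul_eq {α : Type*} [MeasurableSpace α] {μ : Measure α} {c : ℝ} (hc : 0 ≤ c)
    (f : α → ℝ) (q : ℝ≥0∞) :
    eLpNorm (fun x => c * f x) q μ = ENNReal.ofReal c * eLpNorm f q μ := by
  have := eLpNorm_const_smul c f q μ
  rwa [Real.enorm_of_nonneg hc] at this

/-- Subtracting the mean is optimal up to a factor of two. -/
lemma eLpNorm_sub_wAvg_le {n : ℕ} {Ω : Set (Evec n)} (h0 : volume Ω ≠ 0)
    (htop : volume Ω ≠ ∞) {p : ℝ} (hp : 1 ≤ p) {u : Evec n → ℝ}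
    (hu : MemLp u (ENNReal.ofReal p) (volume.restrict Ω)) (c : ℝ) :
    eLpNorm (fun x => u x - wAvg Ω 0 u) (ENNReal.ofReal p) (volume.restrict Ω)
      ≤ 2 * eLpNorm (fun x => u x - c) (ENNReal.ofReal p) (volume.restrict Ω) := by
  have hp0 : 0 < p := by linarith
  have : Fact (volume Ω < ∞) := ⟨htop.lt_top⟩
  set ν := volume.restrict Ω with hν
  have hν0 : ν ≠ 0 := by simpa [hν] using h0
  have hp1 : 1 ≤ ENNReal.ofReal p := by simpa using hp
  have hint : Integrable u ν := hu.integrable hp1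
  have hsub : AEStronglyMeasurable (fun x => u x - c) ν :=
    hu.aestronglyMeasurable.sub aestronglyMeasurable_const
  have havg : c - wAvg Ω 0 u = -((volume.real Ω)⁻¹ * ∫ x in Ω, (u x - c)) := by
    have hne : volume.real Ω ≠ 0 := ENNReal.toReal_ne_zero.2 ⟨h0, htop⟩
    rw [integral_sub hint (integrable_const c)]
    simp only [hν, wAvg, Real.rpow_zero, mul_one, integral_const, smul_eq_mul,
      measureReal_restrict_apply_univ]
    field_simp
    ring
  have hconst : eLpNorm (fun _ => c - wAvg Ω 0 u) (ENNReal.ofReal p) ν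
      ≤ eLpNorm (fun x => u x - c) (ENNReal.ofReal p) ν := by
    have hH := eLpNorm_le_eLpNorm_mul_rpow_measure_univ hp1 hsub
    rw [eLpNorm_one_eq_lintegral_enorm, ENNReal.toReal_one, ENNReal.toReal_ofReal hp0.le, div_one,
      hν, Measure.restrict_apply_univ] at hH
    rw [eLpNorm_const _ (by simpa) hν0, ENNReal.toReal_ofReal hp0.le, havg, enorm_neg, enorm_mul,
      hν, Measure.restrict_apply_univ]
    have hinv : ‖(volume.real Ω)⁻¹‖ₑ = (volume Ω)⁻¹ := by
      rw [Real.enorm_of_nonneg (by positivity), measureReal_def, ENNReal.ofReal_inv_of_pos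
        (ENNReal.toReal_pos h0 htop), ENNReal.ofReal_toReal htop]
    rw [hinv]
    calc _ ≤ (volume Ω)⁻¹ * (eLpNorm (fun x => u x - c) (ENNReal.ofReal p) (volume.restrict Ω)
            * volume Ω ^ (1 - 1 / p)) * volume Ω ^ (1 / p) := by
          gcongr
          exact (enorm_integral_le_lintegral_enorm _).trans hH
      _ = eLpNorm (fun x => u x - c) (ENNReal.ofReal p) (volume.restrict Ω)
            * ((volume Ω)⁻¹ * (volume Ω ^ (1 - 1 / p) * volume Ω ^ (1 / p))) := by ring
      _ = _ := by
          rw [← ENNReal.rpow_add _ _ h0 htop, sub_add_cancel, ENNReal.rpow_one,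
            ENNReal.inv_mul_cancel h0 htop, mul_one]
  calc eLpNorm (fun x => u x - wAvg Ω 0 u) (ENNReal.ofReal p) ν
      = eLpNorm ((fun x => u x - c) + fun _ => c - wAvg Ω 0 u) (ENNReal.ofReal p) ν := by
        congr 1; ext x; simp
    _ ≤ _ := eLpNorm_add_le hsub aestronglyMeasurable_const hp1
    _ ≤ _ := by rw [two_mul]; gcongr

/-- Korn's inequality applied to `w` times an infinitesimal rotation. -/
lemma eLpNorm_le_of_korn {n : ℕ} (hn : 2 ≤ n) {Ω Q : Set (Evec n)} (hΩ : IsOpen Ω)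
    (hQm : MeasurableSet Q) (hQΩ : Q ⊆ Ω) {M : ℝ} (hM : ∀ x ∈ Ω, ‖x‖ ≤ M) (hM0 : 0 ≤ M)
    {p : ℝ} (hp : 1 ≤ p) {C : ℝ}
    (hK : ∀ v : Evec n → Evec n, MemW1Vec Ω p 0 0 v →
      wLp Ω Ω p 0 (DvLen v) ≤
        ENNReal.ofReal C * (wLp Ω Ω p 0 (epsLen v) + wLp Ω Q p 0 (DvLen v)))
    {w : Evec n → ℝ} (hw : MemW1 Ω p 0 0 w) :
    eLpNorm w (ENNReal.ofReal p) (volume.restrict Ω) ≤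
      ENNReal.ofReal C *
        (ENNReal.ofReal n * (ENNReal.ofReal M *
            eLpNorm (gradLen w) (ENNReal.ofReal p) (volume.restrict Ω))
          + ENNReal.ofReal n * (eLpNorm w (ENNReal.ofReal p) (volume.restrict Q)
            + ENNReal.ofReal M * eLpNorm (gradLen w) (ENNReal.ofReal p) (volume.restrict Q)))
      + ENNReal.ofReal M * eLpNorm (gradLen w) (ENNReal.ofReal p) (volume.restrict Ω) := by
  obtain ⟨hdiff, hwp, hgp⟩ := hw
  have hp0 : 0 < p := by linarith
  have hp1 : 1 ≤ ENNReal.ofReal p := by simpa using hp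
  rw [wIp_zero_lt_top_iff _ _ hp0] at hwp hgp
  have hΩm := hΩ.measurableSet
  have hd : ∀ x ∈ Ω, DifferentiableAt ℝ w x := fun x hx => hdiff.differentiableAt (hΩ.mem_nhds hx)
  obtain ⟨a, b, hab⟩ : ∃ a b : Fin n, a ≠ b :=
    ⟨⟨0, by lia⟩, ⟨1, by lia⟩, by simp⟩
  have hwm : ∀ S ⊆ Ω, MeasurableSet S → AEStronglyMeasurable (fun x => |w x|)
      (volume.restrict S) := fun S hS hSm =>
    ((hdiff.continuousOn.mono hS).abs).aestronglyMeasurable hSm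
  have hgm : ∀ S : Set (Evec n), AEStronglyMeasurable (fun x => M * gradLen w x)
      (volume.restrict S) := fun S =>
    ((measurable_gradLen w).const_mul M).aestronglyMeasurable
  have hDv : ∀ S ⊆ Ω, MeasurableSet S →
      eLpNorm (DvLen fun y => w y • infRotation a b y) (ENNReal.ofReal p) (volume.restrict S)
        ≤ ENNReal.ofReal n * (eLpNorm w (ENNReal.ofReal p) (volume.restrict S)
          + ENNReal.ofReal M * eLpNorm (gradLen w) (ENNReal.ofReal p) (volume.restrict S)) := by
    intro S hS hSm
    calc _ ≤ eLpNorm (fun x => n * (|w x| + M * gradLen w x)) (ENNReal.ofReal p)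
            (volume.restrict S) :=
          eLpNorm_restrict_mono hSm (fun x hx => by
            rw [abs_of_nonneg (DvLen_nonneg _ x)]
            exact DvLen_smul_infRotation_le hab (hd x (hS hx)) (hM x (hS hx))) _
      _ = ENNReal.ofReal n * eLpNorm ((fun x => |w x|) + fun x => M * gradLen w x)
            (ENNReal.ofReal p) (volume.restrict S) :=
          eLpNorm_const_mul_eq n.cast_nonneg _ _
      _ ≤ _ := by
          gcongr
          refine (eLpNorm_add_le (hwm S hS hSm) (hgm S) hp1).trans ?_
          rw [eLpNorm_const_mul_eq hM0]
          gcongr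
          exact (eLpNorm_norm w).le
  have hmem : MemW1Vec Ω p 0 0 fun y => w y • infRotation a b y := by
    refine ⟨hdiff.smul (infRotation a b).differentiable.differentiableOn, ?_, ?_⟩
    · rw [wIp_zero_lt_top_iff _ _ hp0]
      have hle := eLpNorm_restrict_mono (μ := volume) hΩm
        (f := fun y => ‖w y • infRotation a b y‖)
        (g := fun y => (‖infRotation a b‖ * M) * |w y|) (fun x hx => by
          rw [abs_of_nonneg (norm_nonneg _), norm_smul, mul_comm, Real.norm_eq_abs]
          gcongr
          exact (infRotation a b).le_opNorm_of_le (hM x hx)) (ENNReal.ofReal p)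
      rw [eLpNorm_const_mul_eq (by positivity)] at hle
      refine hle.trans_lt (ENNReal.mul_lt_top ENNReal.ofReal_lt_top ?_)
      exact (eLpNorm_norm w).trans_lt hwp
    · rw [wIp_zero_lt_top_iff _ _ hp0]
      refine (hDv Ω subset_rfl hΩm).trans_lt (ENNReal.mul_lt_top ENNReal.ofReal_lt_top ?_)
      exact ENNReal.add_lt_top.2 ⟨hwp, ENNReal.mul_lt_top ENNReal.ofReal_lt_top hgp⟩
  have hkorn := hK _ hmem
  rw [wLp_zero_eq _ _ hp0, wLp_zero_eq _ _ hp0, wLp_zero_eq _ _ hp0] at hkorn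
  have heps : eLpNorm (epsLen fun y => w y • infRotation a b y) (ENNReal.ofReal p)
      (volume.restrict Ω) ≤ ENNReal.ofReal n * (ENNReal.ofReal M *
        eLpNorm (gradLen w) (ENNReal.ofReal p) (volume.restrict Ω)) := by
    rw [← eLpNorm_const_mul_eq hM0, ← eLpNorm_const_mul_eq n.cast_nonneg]
    refine eLpNorm_restrict_mono hΩm (fun x hx => ?_) _
    rw [abs_of_nonneg (epsLen_nonneg _ x)]
    exact epsLen_smul_infRotation_le hab (hd x hx) (hM x hx)
  calc eLpNorm w (ENNReal.ofReal p) (volume.restrict Ω)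
      ≤ eLpNorm ((DvLen fun y => w y • infRotation a b y) + fun x => M * gradLen w x)
          (ENNReal.ofReal p) (volume.restrict Ω) :=
        eLpNorm_restrict_mono hΩm (fun x hx =>
          abs_le_DvLen_smul_infRotation hab (hd x hx) (hM x hx)) _
    _ ≤ _ := eLpNorm_add_le (measurable_DvLen _).aestronglyMeasurable (hgm Ω) hp1
    _ ≤ _ := by
        rw [eLpNorm_const_mul_eq hM0]
        gcongr
        exact hkorn.trans (by gcongr; exact hDv Q hQΩ hQm)

end Korn

section ClosedCube

variable {n : ℕ} {Q : Set (Evec n)}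

lemma IsClosedCube.eq_iInter (hQ : IsClosedCube Q) :
    ∃ (c : Evec n) (r : ℝ), 0 < r ∧
      Q = ⋂ i, (EuclideanSpace.proj i : Evec n →L[ℝ] ℝ) ⁻¹' Metric.closedBall (c i) r := by
  obtain ⟨c, r, hr, rfl⟩ := hQ
  refine ⟨c, r, hr, ?_⟩
  ext x
  simp [Real.dist_eq]

lemma IsClosedCube.convex (hQ : IsClosedCube Q) : Convex ℝ Q := by
  obtain ⟨c, r, -, rfl⟩ := hQ.eq_iInter
  exact convex_iInter fun i => (convex_closedBall _ _).linear_preimage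
    (EuclideanSpace.proj i : Evec n →L[ℝ] ℝ).toLinearMap

lemma IsClosedCube.isClosed (hQ : IsClosedCube Q) : IsClosed Q := by
  obtain ⟨c, r, -, rfl⟩ := hQ.eq_iInter
  exact isClosed_iInter fun i => Metric.isClosed_closedBall.preimage
    (EuclideanSpace.proj i : Evec n →L[ℝ] ℝ).continuous

lemma IsClosedCube.volume_pos (hQ : IsClosedCube Q) : 0 < volume Q := by
  obtain ⟨c, r, hr, rfl⟩ := hQ
  refine (Metric.measure_ball_pos volume c hr).trans_le (measure_mono fun x hx i => ?_)
  exact (PiLp.norm_apply_le (x - c) i).trans (mem_ball_iff_norm.1 hx).le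

end ClosedCube

/-- **Theorem 2.2.** If the Korn inequality
`‖Dv‖_{L^p(Ω)} ≤ C { ‖ε(v)‖_{L^p(Ω)} + ‖Dv‖_{L^p(Q)} }` holds for all
`v ∈ W^{1,p}(Ω)ⁿ` and a closed cube `Q ⊆ Ω`, then the Poincaré inequality
`∫_Ω |u − u_Ω|^p ≤ C' ∫_Ω |∇u|^p` holds for all `u ∈ W^{1,p}(Ω)`. -/
theorem korn_tilde_implies_poincare {n : ℕ} (hn : 2 ≤ n) (Ω Q : Set (Evec n)) (p : ℝ)
    (hΩ : IsBoundedDomain Ω) (hp : 1 < p) (hQ : IsClosedCube Q) (hQΩ : Q ⊆ Ω) (C : ℝ)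
    (hK : ∀ v : Evec n → Evec n, MemW1Vec Ω p 0 0 v →
      wLp Ω Ω p 0 (DvLen v) ≤
        ENNReal.ofReal C * (wLp Ω Ω p 0 (epsLen v) + wLp Ω Q p 0 (DvLen v))) :
    ∃ C' > 0, ∀ u : Evec n → ℝ, MemW1 Ω p 0 0 u →
      wIp Ω Ω p 0 (fun x => u x - wAvg Ω 0 u) ≤
        ENNReal.ofReal C' * wIp Ω Ω p 0 (gradLen u) := by
  obtain ⟨hΩo, hΩc, hΩb⟩ := hΩ
  have hp0 : 0 < p := by linarith
  obtain ⟨M, hM0, hM⟩ := hΩb.exists_pos_norm_le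
  have hvol0 : volume Ω ≠ 0 := (hΩo.measure_pos volume hΩc.nonempty).ne'
  have hvolt : volume Ω ≠ ∞ := hΩb.measure_lt_top.ne
  have : Fact (volume Ω < ∞) := ⟨hvolt.lt_top⟩
  obtain ⟨A, hA⟩ := exists_eLpNorm_sub_const_le_of_convex volume hQ.convex
    hQ.isClosed.measurableSet (hΩb.subset hQΩ) hQ.volume_pos.ne' hp.le
  let K : ℝ≥0 := 2 * (C.toNNReal * ((n : ℝ).toNNReal * M.toNNReal
    + (n : ℝ).toNNReal * (A + M.toNNReal)) + M.toNNReal)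
  refine ⟨(K : ℝ) ^ p + 1, by positivity, fun u hu => ?_⟩
  obtain ⟨hud, hup, hug⟩ := hu
  obtain ⟨c, hc⟩ := hA u fun x hx => hud.differentiableAt (hΩo.mem_nhds (hQΩ hx))
  have humem : MemLp u (ENNReal.ofReal p) (volume.restrict Ω) :=
    ⟨hud.continuousOn.aestronglyMeasurable hΩo.measurableSet,
      (wIp_zero_lt_top_iff Ω Ω hp0 u).1 hup⟩
  have hgrad : gradLen (fun x => u x - c) = gradLen u := by
    ext x
    simp [gradLen, fderiv_sub_const]
  have hw : MemW1 Ω p 0 0 fun x => u x - c := by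
    refine ⟨hud.sub_const c, ?_, hgrad ▸ hug⟩
    rw [wIp_zero_lt_top_iff Ω Ω hp0]
    exact (humem.sub (memLp_const c)).2
  have hQΩ' : volume.restrict Q ≤ volume.restrict Ω := Measure.restrict_mono hQΩ le_rfl
  have hmain : eLpNorm (fun x => u x - wAvg Ω 0 u) (ENNReal.ofReal p) (volume.restrict Ω)
      ≤ K * eLpNorm (gradLen u) (ENNReal.ofReal p) (volume.restrict Ω) := by
    refine (eLpNorm_sub_wAvg_le hvol0 hvolt hp.le humem c).trans ?_
    have hkorn := eLpNorm_le_of_korn hn hΩo hQ.isClosed.measurableSet hQΩ hM hM0.le hp.le hK hw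
    rw [hgrad] at hkorn
    have hgQ := eLpNorm_mono_measure (p := ENNReal.ofReal p) (gradLen u) hQΩ'
    rw [← eLpNorm_norm (fderiv ℝ u)] at hc
    have hcQ := hc.trans (mul_le_mul_right hgQ (A : ℝ≥0∞))
    set G := eLpNorm (gradLen u) (ENNReal.ofReal p) (volume.restrict Ω)
    calc _ ≤ 2 * (ENNReal.ofReal C * (ENNReal.ofReal n * (ENNReal.ofReal M * G)
            + ENNReal.ofReal n * (A * G + ENNReal.ofReal M * G)) + ENNReal.ofReal M * G) := by
          gcongr
          exact hkorn.trans (by gcongr)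
      _ = K * G := by
          simp only [K, ENNReal.ofReal]
          push_cast
          ring
  rw [wIp_zero_eq_eLpNorm_rpow Ω Ω hp0, wIp_zero_eq_eLpNorm_rpow Ω Ω hp0]
  refine (ENNReal.rpow_le_rpow hmain hp0.le).trans ?_
  rw [ENNReal.mul_rpow_of_nonneg _ _ hp0.le]
  gcongr
  rw [← ENNReal.ofReal_coe_nnreal, ENNReal.ofReal_rpow_of_nonneg K.coe_nonneg hp0.le]
  exact ENNReal.ofReal_le_ofReal (by linarith)
end
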